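/- Let G=(V,E) be a finite simple undirected graph with preferences as described, assume P≠∅, let x∈P, and let σ be a strongly stable matching in G. Let e be an edge of σ. Then either e ⊆ R' or e ∩ R' = ∅. -/

import Mathlib

/-!
Common setup: a finite simple undirected graph `G = (V, E)` where edges are
elements of `Sym2 V`, together with, for each vertex `v`, a complete and
transitive preference relation `pref v` on `E(v) ∪ {∅}` (the unmatched
option `∅` is encoded as `none : Option (Sym2 V)`), where every incident
edge is strictly preferred to `∅`.
-/

/-- A roommates instance: a finite simple graph with preferences. -/
structure RSetup (V : Type*) [Fintype V] [DecidableEq V] where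
  /-- the edge set -/
  E : Finset (Sym2 V)
  /-- the graph is simple: no loops -/
  not_diag : ∀ e ∈ E, ¬ e.IsDiag
  /-- the preference relation `≿ᵥ` of each vertex, on `E(v) ∪ {∅}` -/
  pref : V → Option (Sym2 V) → Option (Sym2 V) → Prop
  /-- completeness of `≿ᵥ` on `E(v) ∪ {∅}` -/
  pref_total : ∀ v : V, ∀ a b : Option (Sym2 V),
    (∀ e, a = some e → e ∈ E ∧ v ∈ e) → (∀ e, b = some e → e ∈ E ∧ v ∈ e) →
    pref v a b ∨ pref v b a
  /-- transitivity of `≿ᵥ` on `E(v) ∪ {∅}` -/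
  pref_trans : ∀ v : V, ∀ a b c : Option (Sym2 V),
    (∀ e, a = some e → e ∈ E ∧ v ∈ e) → (∀ e, b = some e → e ∈ E ∧ v ∈ e) →
    (∀ e, c = some e → e ∈ E ∧ v ∈ e) →
    pref v a b → pref v b c → pref v a c
  /-- every incident edge is strictly preferred to being unmatched -/
  pref_none : ∀ v : V, ∀ e ∈ E, v ∈ e →
    pref v (some e) none ∧ ¬ pref v none (some e)

namespace RSetup

variable {V : Type*} [Fintype V] [DecidableEq V] (S : RSetup V)

/-- `a ≻ᵥ b` : strict preference. -/
def SPref (v : V) (a b : Option (Sym2 V)) : Prop :=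
  S.pref v a b ∧ ¬ S.pref v b a

/-- `a ∼ᵥ b` : indifference. -/
def IPref (v : V) (a b : Option (Sym2 V)) : Prop :=
  S.pref v a b ∧ S.pref v b a

/-- `F(v)` : the set of edges in `F` incident to `v`. -/
def inc (F : Finset (Sym2 V)) (v : V) : Finset (Sym2 V) :=
  F.filter (fun e => v ∈ e)

/-- a matching in `G` -/
def IsMatching (μ : Finset (Sym2 V)) : Prop :=
  μ ⊆ S.E ∧ ∀ v : V, (inc μ v).card ≤ 1

/-- `μ(v)` : the edge of `μ` incident to `v` (or `none`). -/
noncomputable def matchOf (μ : Finset (Sym2 V)) (v : V) : Option (Sym2 V) :=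
  (inc μ v).toList.head?

/-- `e` blocks the matching `μ`. -/
def Blocks (μ : Finset (Sym2 V)) (e : Sym2 V) : Prop :=
  e ∈ S.E ∧ e ∉ μ ∧ (∀ v ∈ e, S.pref v (some e) (matchOf μ v)) ∧
    (∃ v ∈ e, S.SPref v (some e) (matchOf μ v))

/-- a strongly stable matching in `G` -/
def StronglyStable (μ : Finset (Sym2 V)) : Prop :=
  S.IsMatching μ ∧ ∀ e : Sym2 V, ¬ S.Blocks μ e

/-- `x(W) = ∑_{e ∈ W} x(e)` -/
def xS (x : Sym2 V → ℝ) (W : Finset (Sym2 V)) : ℝ := ∑ e ∈ W, x e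

/-- `x ∈ ℝ₊^E`, encoded as a nonnegative function on `Sym2 V` vanishing
outside `E`. -/
def IsVec (x : Sym2 V → ℝ) : Prop :=
  (∀ e, 0 ≤ x e) ∧ ∀ e ∉ S.E, x e = 0

open Classical in
/-- `E[∼ᵥ e] = {f ∈ E(v) : f ∼ᵥ e}` -/
noncomputable def simSet (v : V) (e : Sym2 V) : Finset (Sym2 V) :=
  (inc S.E v).filter (fun f => S.IPref v (some f) (some e))

open Classical in
/-- `E[≻ᵥ e] = {f ∈ E(v) : f ≻ᵥ e}` -/
noncomputable def succSet (v : V) (e : Sym2 V) : Finset (Sym2 V) :=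
  (inc S.E v).filter (fun f => S.SPref v (some f) (some e))

open Classical in
/-- `E⟨X⟩ = {e ∈ E : e ⊆ X}` -/
noncomputable def esub (X : Finset V) : Finset (Sym2 V) :=
  S.E.filter (fun e => ∀ u ∈ e, u ∈ X)

/-- constraint (1): `x(E(v)) ≤ 1` for every vertex `v` -/
def C1 (x : Sym2 V → ℝ) : Prop := ∀ v : V, xS x (inc S.E v) ≤ 1

/-- constraint (2): `x(E[∼ᵥ e]) + ∑_{w ∈ e} x(E[≻_w e]) ≥ 1`
for every edge `e ∈ E` and `v ∈ e` -/
def C2 (x : Sym2 V → ℝ) : Prop := ∀ v w : V, s(v, w) ∈ S.E →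
  xS x (S.simSet v s(v, w)) +
    (xS x (S.succSet v s(v, w)) + xS x (S.succSet w s(v, w))) ≥ 1

/-- constraint (3): `x(E⟨X⟩) ≤ ⌊|X|/2⌋` for every odd `X ⊆ V` -/
def C3 (x : Sym2 V → ℝ) : Prop := ∀ X : Finset V, Odd X.card →
  xS x (S.esub X) ≤ ((X.card / 2 : ℕ) : ℝ)

/-- membership in the polytope `P` -/
def memP (x : Sym2 V → ℝ) : Prop := S.IsVec x ∧ S.C1 x ∧ S.C2 x ∧ S.C3 x

/-- the characteristic vector `χ_μ` of a set of edges -/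
def chi (μ : Finset (Sym2 V)) : Sym2 V → ℝ := fun e => if e ∈ μ then 1 else 0

open Classical in
/-- `E_x = {e ∈ E : x(e) > 0}` -/
noncomputable def supp (x : Sym2 V → ℝ) : Finset (Sym2 V) :=
  S.E.filter (fun e => 0 < x e)

/-- `V₁` : the set of vertices `v` with `x(E(v)) > 0` for some `x ∈ P` -/
def V1 : Set V := {v : V | ∃ x : Sym2 V → ℝ, S.memP x ∧ 0 < xS x (inc S.E v)}

open Classical in
/-- `B_x(v)` : the best edges in `E_x(v)` for `v` -/
noncomputable def Bset (x : Sym2 V → ℝ) (v : V) : Finset (Sym2 V) :=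
  (inc (S.supp x) v).filter
    (fun e => ∀ f ∈ inc (S.supp x) v, S.pref v (some e) (some f))

open Classical in
/-- `W_x(v)` : the worst edges in `E_x(v)` for `v` -/
noncomputable def Wset (x : Sym2 V → ℝ) (v : V) : Finset (Sym2 V) :=
  (inc (S.supp x) v).filter
    (fun e => ∀ f ∈ inc (S.supp x) v, S.pref v (some f) (some e))

/-- a nonempty `F ⊆ E(v)` is flat if `v` is indifferent among its members -/
def Flat (v : V) (F : Finset (Sym2 V)) : Prop :=
  F.Nonempty ∧ ∀ e ∈ F, ∀ f ∈ F, S.IPref v (some e) (some f)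

open Classical in
/-- `T_x` : edges `e ∈ E⟨V₁⟩` such that, for each `v ∈ e`, either
`e ∈ B_x(v) ∪ W_x(v)` or `B_x(v) ≻ᵥ e ≻ᵥ W_x(v)`. -/
noncomputable def Tset (x : Sym2 V → ℝ) : Finset (Sym2 V) :=
  (S.E.filter (fun e => ∀ u ∈ e, u ∈ S.V1)).filter (fun e => ∀ v ∈ e,
    (e ∈ S.Bset x v ∪ S.Wset x v) ∨
      ((∀ f ∈ S.Bset x v, S.SPref v (some f) (some e)) ∧
        (∀ f ∈ S.Wset x v, S.SPref v (some e) (some f))))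

/-- membership in `P(F) = {x ∈ P : x(e) = 0 for all e ∈ E \ F}` -/
def memPF (F : Finset (Sym2 V)) (x : Sym2 V → ℝ) : Prop :=
  S.memP x ∧ ∀ e ∈ S.E, e ∉ F → x e = 0

open Classical in
/-- `E⁺ = {e ∈ E : e ∈ E_z for some z ∈ P}` -/
noncomputable def Eplus : Finset (Sym2 V) :=
  S.E.filter (fun e => ∃ z : Sym2 V → ℝ, S.memP z ∧ 0 < z e)

open Classical in
/-- `P'` : given `x ∈ P` and a strongly stable matching `σ`, the set of
vertices `v ∈ V₁` with `W_x(v) ≻ᵥ σ(v)`, or with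
`B_x(v) ≻ᵥ W_x(v)` and `W_x(v) ∼ᵥ σ(v)`. -/
def Pset (x : Sym2 V → ℝ) (σ : Finset (Sym2 V)) : Set V :=
  {v : V | v ∈ S.V1 ∧
    ((∀ f ∈ S.Wset x v, S.SPref v (some f) (matchOf σ v)) ∨
      ((∀ f ∈ S.Bset x v, ∀ g ∈ S.Wset x v, S.SPref v (some f) (some g)) ∧
        (∀ f ∈ S.Wset x v, S.IPref v (some f) (matchOf σ v))))}

/-- `Q'` : given `x ∈ P` and a strongly stable matching `σ`, the set of
vertices `v ∈ V₁` with `σ(v) ≻ᵥ B_x(v)`, or with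
`B_x(v) ≻ᵥ W_x(v)` and `B_x(v) ∼ᵥ σ(v)`. -/
def Qset (x : Sym2 V → ℝ) (σ : Finset (Sym2 V)) : Set V :=
  {v : V | v ∈ S.V1 ∧
    ((∀ f ∈ S.Bset x v, S.SPref v (matchOf σ v) (some f)) ∨
      ((∀ f ∈ S.Bset x v, ∀ g ∈ S.Wset x v, S.SPref v (some f) (some g)) ∧
        (∀ f ∈ S.Bset x v, S.IPref v (some f) (matchOf σ v))))}

/-- `R'` : given `x ∈ P` and a strongly stable matching `σ`, the set of
vertices `v ∈ V₁` such that `E_x(v)` is flat and `E_x(v) ∼ᵥ σ(v)`. -/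
def Rset (x : Sym2 V → ℝ) (σ : Finset (Sym2 V)) : Set V :=
  {v : V | v ∈ S.V1 ∧ S.Flat v (inc (S.supp x) v) ∧
    ∀ f ∈ inc (S.supp x) v, S.IPref v (some f) (matchOf σ v)}

end RSetup

namespace RSetup

theorem mem_inc {V : Type*} [DecidableEq V] {F : Finset (Sym2 V)} {v : V} {e : Sym2 V} :
    e ∈ inc F v ↔ e ∈ F ∧ v ∈ e := by
  simp [inc]

theorem mem_of_matchOf_eq_some {V : Type*} [DecidableEq V] {σ : Finset (Sym2 V)} {v : V}
    {e : Sym2 V} (h : matchOf σ v = some e) : e ∈ σ ∧ v ∈ e := by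
  have := List.mem_of_mem_head? (Option.mem_def.2 h)
  rwa [Finset.mem_toList, mem_inc] at this

variable {V : Type*} [Fintype V] [DecidableEq V] (S : RSetup V)

open Classical in
/-- The edges incident to `v` that `v` strictly prefers to its `σ`-edge. -/
noncomputable def betterSet (σ : Finset (Sym2 V)) (v : V) : Finset (Sym2 V) :=
  (inc S.E v).filter (fun f => S.SPref v (some f) (matchOf σ v))

open Classical in
/-- The edges incident to `v` to which `v` strictly prefers its `σ`-edge. -/
noncomputable def worseSet (σ : Finset (Sym2 V)) (v : V) : Finset (Sym2 V) :=
  (inc S.E v).filter (fun f => S.SPref v (matchOf σ v) (some f))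

variable {S} {σ : Finset (Sym2 V)} {x : Sym2 V → ℝ}

theorem IsMatching.eq_of_mem (hσ : S.IsMatching σ) {v : V} {e f : Sym2 V}
    (he : e ∈ σ) (hve : v ∈ e) (hf : f ∈ σ) (hvf : v ∈ f) : e = f :=
  Finset.card_le_one.1 (hσ.2 v) e (mem_inc.2 ⟨he, hve⟩) f (mem_inc.2 ⟨hf, hvf⟩)

theorem IsMatching.matchOf_eq_some (hσ : S.IsMatching σ) {v : V} {e : Sym2 V}
    (he : e ∈ σ) (hve : v ∈ e) : matchOf σ v = some e := by
  cases h : matchOf σ v with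
  | none =>
    have h0 : inc σ v = ∅ := by simpa [matchOf] using h
    have h1 : e ∈ inc σ v := mem_inc.2 ⟨he, hve⟩
    simp [h0] at h1
  | some f =>
    obtain ⟨hf, hvf⟩ := mem_of_matchOf_eq_some h
    rw [hσ.eq_of_mem he hve hf hvf]

theorem IsMatching.mem_of_matchOf (hσ : S.IsMatching σ) (v : V) :
    ∀ e, matchOf σ v = some e → e ∈ S.E ∧ v ∈ e := fun _ h =>
  ⟨hσ.1 (mem_of_matchOf_eq_some h).1, (mem_of_matchOf_eq_some h).2⟩

theorem IsMatching.pref_total (hσ : S.IsMatching σ) {v : V} {f : Sym2 V}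
    (hf : f ∈ S.E) (hv : v ∈ f) :
    S.pref v (some f) (matchOf σ v) ∨ S.pref v (matchOf σ v) (some f) :=
  S.pref_total v _ _ (by rintro e ⟨⟩; exact ⟨hf, hv⟩) (hσ.mem_of_matchOf v)

/-- An edge improving on `σ` at one end is strictly worse than `σ` at the other end. -/
theorem StronglyStable.sPref_other (hσ : S.StronglyStable σ) {a b : V} (hE : s(a, b) ∈ S.E)
    (h : S.SPref a (some s(a, b)) (matchOf σ a)) :
    S.SPref b (matchOf σ b) (some s(a, b)) := by
  have hmem : s(a, b) ∉ σ := by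
    intro hm
    rw [hσ.1.matchOf_eq_some hm (Sym2.mem_mk_left a b)] at h
    exact h.2 h.1
  have hb : ¬ S.pref b (some s(a, b)) (matchOf σ b) := by
    intro hb
    refine hσ.2 s(a, b) ⟨hE, hmem, ?_, a, Sym2.mem_mk_left a b, h⟩
    intro w hw
    rcases Sym2.mem_iff.1 hw with rfl | rfl
    · exact h.1
    · exact hb
  exact ⟨(hσ.1.pref_total hE (Sym2.mem_mk_right a b)).resolve_left hb, hb⟩

theorem StronglyStable.sum_betterSet_le (hσ : S.StronglyStable σ) (hx : S.IsVec x) :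
    ∑ v, xS x (S.betterSet σ v) ≤ ∑ v, xS x (S.worseSet σ v) := by
  classical
  simp only [xS, betterSet, worseSet, inc, Finset.sum_filter]
  rw [Finset.sum_comm, Finset.sum_comm (s := Finset.univ) (t := S.E)]
  refine Finset.sum_le_sum fun f hf => ?_
  induction f using Sym2.ind with
  | _ a b =>
    rw [← Equiv.sum_comp (Equiv.swap a b)
      (fun v => if v ∈ s(a, b) then
        if S.SPref v (matchOf σ v) (some s(a, b)) then x s(a, b) else 0 else 0)]
    refine Finset.sum_le_sum fun v _ => ?_
    have h0 := hx.1 s(a, b)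
    by_cases hv : v ∈ s(a, b) ∧ S.SPref v (some s(a, b)) (matchOf σ v)
    · obtain ⟨hv, hP⟩ := hv
      rcases Sym2.mem_iff.1 hv with rfl | rfl
      · simp [hP, hσ.sPref_other hf hP]
      · rw [Sym2.eq_swap] at hf hP
        have hQ := hσ.sPref_other hf hP
        rw [Sym2.eq_swap] at hP hQ
        simp [hP, hQ]
    · rw [← ite_and, if_neg hv]
      split_ifs <;> simp [h0]

theorem sum_eq_sim_add_succ_add_worse (hσ : S.IsMatching σ) {v : V} {e : Sym2 V}
    (he : e ∈ σ) (hv : v ∈ e) :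
    xS x (inc S.E v) = xS x (S.simSet v e) + xS x (S.succSet v e) + xS x (S.worseSet σ v) := by
  classical
  have hm := hσ.matchOf_eq_some he hv
  simp only [xS, simSet, succSet, worseSet, hm, Finset.sum_filter (s := inc S.E v)]
  rw [← Finset.sum_add_distrib, ← Finset.sum_add_distrib]
  refine Finset.sum_congr rfl fun f hf => ?_
  have ht := hσ.pref_total (mem_inc.1 hf).1 (mem_inc.1 hf).2
  rw [hm] at ht
  unfold IPref SPref
  by_cases h1 : S.pref v (some f) (some e) <;> by_cases h2 : S.pref v (some e) (some f) <;>
    simp_all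

theorem IsMatching.succSet_eq_betterSet (hσ : S.IsMatching σ) {v : V} {e : Sym2 V}
    (he : e ∈ σ) (hv : v ∈ e) : S.succSet v e = S.betterSet σ v := by
  rw [succSet, betterSet, hσ.matchOf_eq_some he hv]

theorem IsMatching.xS_worseSet_le (hσ : S.IsMatching σ) (hx : S.memP x) {v w : V}
    (he : s(v, w) ∈ σ) : xS x (S.worseSet σ v) ≤ xS x (S.betterSet σ w) := by
  have h1 := hx.2.1 v
  have h2 := hx.2.2.1 v w (hσ.1 he)
  rw [sum_eq_sim_add_succ_add_worse hσ he (Sym2.mem_mk_left v w)] at h1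
  rw [hσ.succSet_eq_betterSet he (Sym2.mem_mk_right v w)] at h2
  linarith

theorem xS_nonneg (hx : S.IsVec x) (W : Finset (Sym2 V)) : 0 ≤ xS x W :=
  Finset.sum_nonneg fun e _ => hx.1 e

open Classical in
/-- The partner of `v` in `σ`, or `v` itself if `v` is unmatched. -/
noncomputable def partner (σ : Finset (Sym2 V)) (v : V) : V :=
  if h : ∃ w, s(v, w) ∈ σ then h.choose else v

theorem IsMatching.partner_eq (hσ : S.IsMatching σ) {v w : V} (h : s(v, w) ∈ σ) :
    partner σ v = w := by
  have hex : ∃ w, s(v, w) ∈ σ := ⟨w, h⟩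
  rw [partner, dif_pos hex]
  exact Sym2.congr_right.1
    (hσ.eq_of_mem hex.choose_spec (Sym2.mem_mk_left _ _) h (Sym2.mem_mk_left _ _))

theorem IsMatching.partner_involutive (hσ : S.IsMatching σ) :
    Function.Involutive (partner σ) := by
  intro v
  by_cases h : ∃ w, s(v, w) ∈ σ
  · obtain ⟨w, h⟩ := h
    rw [hσ.partner_eq h]
    exact hσ.partner_eq (by rwa [Sym2.eq_swap])
  · have hv : partner σ v = v := by rw [partner, dif_neg h]
    rw [hv, hv]

theorem worseSet_eq_empty (hv : ¬ ∃ w, s(v, w) ∈ σ) : S.worseSet σ v = ∅ := by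
  have hm : matchOf σ v = none := by
    cases h : matchOf σ v with
    | none => rfl
    | some f =>
      obtain ⟨hf, w, rfl⟩ := mem_of_matchOf_eq_some h
      exact absurd ⟨w, hf⟩ hv
  classical
  refine Finset.filter_eq_empty_iff.2 fun f hf h => ?_
  rw [hm] at h
  exact h.2 (S.pref_none v f (mem_inc.1 hf).1 (mem_inc.1 hf).2).1

/-- Along each edge of a strongly stable matching, the weight strictly better than `σ` at one end
equals the weight strictly worse than `σ` at the other end. -/
theorem StronglyStable.xS_betterSet_eq (hσ : S.StronglyStable σ) (hx : S.memP x) {v w : V}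
    (he : s(v, w) ∈ σ) : xS x (S.betterSet σ v) = xS x (S.worseSet σ w) := by
  have hle : ∀ u ∈ Finset.univ,
      xS x (S.worseSet σ (partner σ u)) ≤ xS x (S.betterSet σ u) := by
    intro u _
    by_cases h : ∃ w, s(u, w) ∈ σ
    · obtain ⟨w, h⟩ := h
      rw [hσ.1.partner_eq h]
      exact hσ.1.xS_worseSet_le hx (by rwa [Sym2.eq_swap])
    · have hu : partner σ u = u := by rw [partner, dif_neg h]
      rw [hu, worseSet_eq_empty h]
      simpa [xS] using xS_nonneg hx.1 (S.betterSet σ u)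
  have hsum : ∑ u, xS x (S.worseSet σ (partner σ u)) = ∑ u, xS x (S.worseSet σ u) :=
    Equiv.sum_comp hσ.1.partner_involutive.toPerm fun u => xS x (S.worseSet σ u)
  have heq := (Finset.sum_eq_sum_iff_of_le hle).1
    (le_antisymm (Finset.sum_le_sum hle) (hsum ▸ hσ.sum_betterSet_le hx.1)) v (Finset.mem_univ v)
  rw [hσ.1.partner_eq he] at heq
  exact heq.symm

theorem mem_inc_supp {v : V} {f : Sym2 V} :
    f ∈ inc (S.supp x) v ↔ (f ∈ S.E ∧ 0 < x f) ∧ v ∈ f := by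
  simp [mem_inc, supp]

theorem xS_eq_zero (hx : S.IsVec x) {W : Finset (Sym2 V)} :
    xS x W = 0 ↔ ∀ f ∈ W, ¬ 0 < x f := by
  rw [xS, Finset.sum_eq_zero_iff_of_nonneg fun f _ => hx.1 f]
  exact forall₂_congr fun f _ => ⟨fun h => h ▸ lt_irrefl _,
    fun h => le_antisymm (not_lt.1 h) (hx.1 f)⟩

theorem StronglyStable.mem_Rset_of_mem (hσ : S.StronglyStable σ) (hx : S.memP x) {u v : V}
    (he : s(u, v) ∈ σ) (hu : u ∈ S.Rset x σ) : v ∈ S.Rset x σ := by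
  classical
  have he' : s(v, u) ∈ σ := by rwa [Sym2.eq_swap]
  have hbu : xS x (S.betterSet σ u) = 0 := by
    refine (xS_eq_zero hx.1).2 fun f hf hpos => ?_
    obtain ⟨hf, hs⟩ := Finset.mem_filter.1 hf
    exact hs.2 (hu.2.2 f (mem_inc_supp.2 ⟨⟨(mem_inc.1 hf).1, hpos⟩, (mem_inc.1 hf).2⟩)).2
  have hwu : xS x (S.worseSet σ u) = 0 := by
    refine (xS_eq_zero hx.1).2 fun f hf hpos => ?_
    obtain ⟨hf, hs⟩ := Finset.mem_filter.1 hf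
    exact hs.2 (hu.2.2 f (mem_inc_supp.2 ⟨⟨(mem_inc.1 hf).1, hpos⟩, (mem_inc.1 hf).2⟩)).1
  have hbv : xS x (S.betterSet σ v) = 0 := (hσ.xS_betterSet_eq hx he').trans hwu
  have hwv : xS x (S.worseSet σ v) = 0 := (hσ.xS_betterSet_eq hx he).symm.trans hbu
  have hpos : 0 < xS x (inc S.E v) := by
    have h := hx.2.2.1 v u (hσ.1.1 he')
    rw [sum_eq_sim_add_succ_add_worse hσ.1 he' (Sym2.mem_mk_left v u)]
    rw [hσ.1.succSet_eq_betterSet he' (Sym2.mem_mk_right v u)] at h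
    linarith
  have hm := hσ.1.matchOf_eq_some he' (Sym2.mem_mk_left v u)
  have hsim : ∀ f ∈ inc (S.supp x) v, S.IPref v (some f) (matchOf σ v) := by
    intro f hf
    obtain ⟨⟨hfE, hf0⟩, hvf⟩ := mem_inc_supp.1 hf
    have hb : ¬ S.SPref v (some f) (matchOf σ v) := fun h =>
      (xS_eq_zero hx.1).1 hbv f (Finset.mem_filter.2 ⟨mem_inc.2 ⟨hfE, hvf⟩, h⟩) hf0
    have hw : ¬ S.SPref v (matchOf σ v) (some f) := fun h =>
      (xS_eq_zero hx.1).1 hwv f (Finset.mem_filter.2 ⟨mem_inc.2 ⟨hfE, hvf⟩, h⟩) hf0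
    have ht := hσ.1.pref_total hfE hvf
    unfold SPref at hb hw
    unfold IPref
    tauto
  refine ⟨⟨x, hx, hpos⟩, ⟨?_, ?_⟩, hsim⟩
  · by_contra hne
    refine hpos.ne' ((xS_eq_zero hx.1).2 fun f hf h0 => hne ⟨f, ?_⟩)
    exact mem_inc_supp.2 ⟨⟨(mem_inc.1 hf).1, h0⟩, (mem_inc.1 hf).2⟩
  · have trans : ∀ f ∈ inc (S.supp x) v, ∀ g ∈ inc (S.supp x) v,
        S.pref v (some f) (some g) := by
      intro f hf g hg
      refine S.pref_trans v _ (matchOf σ v) _ ?_ (hσ.1.mem_of_matchOf v) ?_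
        (hsim f hf).1 (hsim g hg).2
      · rintro _ ⟨⟩
        exact ⟨(mem_inc_supp.1 hf).1.1, (mem_inc_supp.1 hf).2⟩
      · rintro _ ⟨⟩
        exact ⟨(mem_inc_supp.1 hg).1.1, (mem_inc_supp.1 hg).2⟩
    exact fun f hf g hg => ⟨trans f hf g hg, trans g hg f hf⟩

end RSetup

open RSetup in
/-- (B2) of Lemma 10: for `x ∈ P`, a strongly stable matching
`σ`, and an edge `e ∈ σ`, either `e ⊆ R'` or `e ∩ R' = ∅`. -/
theorem Rset_subset_or_disjoint
    {V : Type*} [Fintype V] [DecidableEq V] (S : RSetup V)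
    (hP : ∃ y : Sym2 V → ℝ, S.memP y)
    (x : Sym2 V → ℝ) (hx : S.memP x)
    (σ : Finset (Sym2 V)) (hσ : S.StronglyStable σ)
    (e : Sym2 V) (he : e ∈ σ) :
    (∀ u ∈ e, u ∈ S.Rset x σ) ∨ (∀ u ∈ e, u ∉ S.Rset x σ) := by
  induction e using Sym2.ind with
  | _ a b =>
    have hab : a ∈ S.Rset x σ ↔ b ∈ S.Rset x σ :=
      ⟨hσ.mem_Rset_of_mem hx he, hσ.mem_Rset_of_mem hx (by rwa [Sym2.eq_swap])⟩
    simp only [Sym2.mem_iff, forall_eq_or_imp, forall_eq]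
    tauto
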